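/- Suppose that the ergodic metric dynamical system (X₂,μ₂,T₂) is a factor of the ergodic metric dynamical system (X₁,μ₁,T₁) (i.e., there is a measurable map φ: X₁ → X₂ with φ_*μ₁ = μ₂ and φ∘T₁ = T₂∘φ almost everywhere), and let h¹ = {h¹_n} be a scaling entropy sequence of (X₁,μ₁,T₁) and h² = {h²_n} a scaling entropy sequence of (X₂,μ₂,T₂). Then h²_n = O(h¹_n) as n → +∞. -/

import Mathlib

open MeasureTheory Filter Set
open scoped ENNReal

/-- A semimetric on a set: symmetric, nonnegative, vanishing on the diagonal,
satisfying the triangle inequality. -/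
structure IsSemimetric {Y : Type*} (ρ : Y → Y → ℝ) : Prop where
  refl : ∀ x, ρ x x = 0
  symm : ∀ x y, ρ x y = ρ y x
  nonneg : ∀ x y, 0 ≤ ρ x y
  triangle : ∀ x y z, ρ x z ≤ ρ x y + ρ y z

/-- `ρ` is separable on the set `s`: some countable subset of `s` is `ρ`-dense in `s`. -/
def SeparableWRT {Y : Type*} (ρ : Y → Y → ℝ) (s : Set Y) : Prop :=
  ∃ D : Set Y, D.Countable ∧ D ⊆ s ∧ ∀ x ∈ s, ∀ ε : ℝ, 0 < ε → ∃ y ∈ D, ρ x y < ε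

variable {X : Type*} [MeasurableSpace X]

/-- A semimetric is admissible if it is separable on a measurable subset of full measure. -/
def IsAdmissible (μ : Measure X) (ρ : X → X → ℝ) : Prop :=
  ∃ s : Set X, MeasurableSet s ∧ μ sᶜ = 0 ∧ SeparableWRT ρ s

/-- There is a partition `X₀, X₁, …, X_k` of `X` into measurable pieces with `μ X₀ < ε`
and the `ρ`-diameter of `X_j` (1 ≤ j ≤ k) less than `ε`. -/
def IsEntropyPartition (μ : Measure X) (ρ : X → X → ℝ) (ε : ℝ) (k : ℕ) : Prop :=
  ∃ P : Fin (k + 1) → Set X,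
    (∀ j, MeasurableSet (P j)) ∧
    Pairwise (fun i j => Disjoint (P i) (P j)) ∧
    (⋃ j, P j) = Set.univ ∧
    μ (P 0) < ENNReal.ofReal ε ∧
    ∀ j, j ≠ 0 → ∀ x ∈ P j, ∀ y ∈ P j, ρ x y < ε

open scoped Classical in
/-- The Kolmogorov ε-entropy `ℍ_ε(X, μ, ρ)` of a semimetric triple: `log₂ k` for the least
`k` admitting an entropy partition, and `∞` if there is none. -/
noncomputable def epsEntropy (μ : Measure X) (ρ : X → X → ℝ) (ε : ℝ) : ℝ≥0∞ :=
  if h : ∃ k, IsEntropyPartition μ ρ ε k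
  then ENNReal.ofReal (Real.logb 2 (Nat.find h))
  else ⊤

/-- The shift `T^k ρ` of a semimetric by the `k`-th power (k ∈ ℤ) of an automorphism. -/
def shiftSemimetric (T : Equiv.Perm X) (k : ℤ) (ρ : X → X → ℝ) : X → X → ℝ :=
  fun x y => ρ ((T ^ k) x) ((T ^ k) y)

/-- The average `T^n_av ρ = (1/n) ∑_{k=0}^{n-1} T^k ρ`. -/
noncomputable def avgSemimetric (T : Equiv.Perm X) (ρ : X → X → ℝ) (n : ℕ) : X → X → ℝ :=
  fun x y => (∑ k ∈ Finset.range n, ρ ((T ^ k) x) ((T ^ k) y)) / n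

/-- `h` is a scaling sequence for the semimetric `ρ` w.r.t. the automorphism `T`:
`h` is positive, for every `ε > 0` the sequence `ℍ_ε(X, μ, T^n_av ρ)/h_n` has finite limsup,
and for all sufficiently small `ε > 0` it has positive liminf. Sequences are indexed by
`n = 1, 2, …`. -/
def IsScalingSeq (μ : Measure X) (T : Equiv.Perm X) (ρ : X → X → ℝ) (h : ℕ → ℝ) : Prop :=
  (∀ n, 1 ≤ n → 0 < h n) ∧
  (∀ ε : ℝ, 0 < ε →
    Filter.limsup (fun n : ℕ =>
      epsEntropy μ (avgSemimetric T ρ n) ε / ENNReal.ofReal (h n)) Filter.atTop < ⊤) ∧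
  (∃ ε₀ : ℝ, 0 < ε₀ ∧ ∀ ε : ℝ, 0 < ε → ε < ε₀ →
    0 < Filter.liminf (fun n : ℕ =>
      epsEntropy μ (avgSemimetric T ρ n) ε / ENNReal.ofReal (h n)) Filter.atTop)

/-- `ρ` is (two-sided) generating for `(X, μ, T)`: the shifts `T^k ρ`, `k ∈ ℤ`, separate points
of a subset of full measure. -/
def IsGenerating (μ : Measure X) (T : Equiv.Perm X) (ρ : X → X → ℝ) : Prop :=
  ∃ s : Set X, MeasurableSet s ∧ μ sᶜ = 0 ∧
    ∀ x ∈ s, ∀ y ∈ s, x ≠ y → ∃ k : ℤ, 0 < ρ ((T ^ k) x) ((T ^ k) y)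

/-- `h` is a scaling entropy sequence of the system `(X, μ, T)`: it is a scaling sequence for
some summable admissible measurable generating semimetric. -/
def IsScalingEntropySeq (μ : Measure X) (T : Equiv.Perm X) (h : ℕ → ℝ) : Prop :=
  ∃ ρ : X → X → ℝ, IsSemimetric ρ ∧
    Measurable (fun p : X × X => ρ p.1 p.2) ∧
    MeasureTheory.Integrable (fun p : X × X => ρ p.1 p.2) (μ.prod μ) ∧
    IsAdmissible μ ρ ∧ IsGenerating μ T ρ ∧ IsScalingSeq μ T ρ h

/-- The (Shannon) entropy, base 2, of the countable partition of `X` into the fibers of `f`. -/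
noncomputable def partitionEntropy {ι : Type*} [Countable ι] (μ : Measure X) (f : X → ι) :
    ℝ≥0∞ :=
  ∑' i : ι, ENNReal.ofReal (-((μ (f ⁻¹' {i})).toReal * Real.logb 2 (μ (f ⁻¹' {i})).toReal))

/-- The Kolmogorov (measure-theoretic) entropy of the automorphism `T`: the supremum over all
finite measurable partitions `ξ` of `lim_n H(ξ ∨ T⁻¹ξ ∨ ⋯ ∨ T^{-(n-1)}ξ)/n`. -/
noncomputable def kolmogorovEntropy (μ : Measure X) (T : Equiv.Perm X) : ℝ≥0∞ :=
  ⨆ (m : ℕ) (ξ : X → Fin m) (_ : ∀ i, MeasurableSet (ξ ⁻¹' {i})),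
    Filter.limsup (fun n : ℕ =>
      partitionEntropy μ (fun x => fun i : Fin n => ξ ((T ^ (-(i : ℤ))) x)) / (n : ℝ≥0∞))
      Filter.atTop

/-- The Kushnirenko `A`-entropy of `T` along the sequence `A = {a_n}`: the supremum over all
countable measurable partitions `ξ` of finite entropy of
`limsup_n H(T^{a_1}ξ ∨ ⋯ ∨ T^{a_n}ξ)/n`. -/
noncomputable def kushnirenkoEntropy (μ : Measure X) (T : Equiv.Perm X) (a : ℕ → ℕ) : ℝ≥0∞ :=
  ⨆ (ξ : X → ℕ) (_ : ∀ i, MeasurableSet (ξ ⁻¹' {i})) (_ : partitionEntropy μ ξ < ⊤),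
    Filter.limsup (fun n : ℕ =>
      partitionEntropy μ (fun x => fun i : Fin n => ξ ((T ^ (a i)) x)) / (n : ℝ≥0∞))
      Filter.atTop

/-- The Koopman operator `f ↦ f ∘ T` on `L²(X, μ)` has purely point spectrum: `L²(X, μ)`
possesses an orthonormal (Hilbert) basis consisting of eigenfunctions of `f ↦ f ∘ T`. -/
def HasPurePointSpectrum (μ : Measure X) (T : X → X) : Prop :=
  ∃ (ι : Type) (b : HilbertBasis ι ℂ (MeasureTheory.Lp ℂ 2 μ)),
    ∀ i : ι, ∃ c : ℂ, (fun x => (b i : MeasureTheory.Lp ℂ 2 μ) (T x))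
      =ᵐ[μ] fun x => c * (b i : MeasureTheory.Lp ℂ 2 μ) x


theorem aux_tail {X : Type*} [MeasurableSpace X] (μ : Measure X) [IsProbabilityMeasure μ]
    (u : X → ℝ) (hu : Measurable u) (hfin : ∫⁻ x, ENNReal.ofReal (u x) ∂μ ≠ ⊤)
    (η : ℝ) (hη : 0 < η) :
    ∃ M : ℝ, 0 < M ∧ ∫⁻ x in {x | M < u x}, ENNReal.ofReal (u x) ∂μ < ENNReal.ofReal η := by
  have h1 : Tendsto (fun n : ℕ => μ {x | (n : ℝ) < u x}) atTop (nhds 0) := by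
    have h2 := tendsto_measure_iInter_atTop (μ := μ) (s := fun n : ℕ => {x | (n : ℝ) < u x})
      (fun n => (measurableSet_lt measurable_const hu).nullMeasurableSet)
      (fun a b hab x hx => by
        simp only [mem_ofPred_eq] at hx ⊢
        exact lt_of_le_of_lt (Nat.cast_le.2 hab) hx)
      ⟨0, measure_ne_top _ _⟩
    have h3 : (⋂ n : ℕ, {x | (n : ℝ) < u x}) = ∅ := by
      ext x
      simp only [mem_iInter, mem_ofPred_eq, mem_empty_iff_false, iff_false, not_forall, not_lt]
      exact exists_nat_ge (u x)
    rw [h3, measure_empty] at h2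
    exact h2
  have h4 := tendsto_setLIntegral_zero hfin h1
  have h5 := (h4.eventually_lt_const (u := ENNReal.ofReal η) (by simpa using hη)).and
    (eventually_ge_atTop 1)
  obtain ⟨n, hn, hn1⟩ := h5.exists
  exact ⟨n, by exact_mod_cast hn1, hn⟩

theorem aux_static_top {X : Type*} [MeasurableSpace X] [TopologicalSpace X] [PolishSpace X]
    [BorelSpace X] (μ : Measure X) [IsProbabilityMeasure μ]
    (g F : ℕ → X → ℝ) (hg : ∀ i, Continuous (g i)) (hF : ∀ i, Continuous (F i))
    (u : X → ℝ) (hu : Measurable u) (hu0 : ∀ x, 0 ≤ u x)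
    (hfin : ∫⁻ x, ENNReal.ofReal (u x) ∂μ ≠ ⊤)
    (S : Set X) (hS : MeasurableSet S) (hSc : μ Sᶜ = 0)
    (hinj : ∀ x ∈ S, ∀ y ∈ S, (∀ i, g i x = g i y) → x = y)
    (hdense : ∀ x ∈ S, ∀ ε : ℝ, 0 < ε → ∃ j, F j x < ε)
    (σ : X → X → ℝ) (hσF : ∀ j x y, σ x y ≤ F j x + F j y) (hσu : ∀ x y, σ x y ≤ u x + u y)
    (η : ℝ) (hη : 0 < η) :
    ∃ (N : ℕ) (C : ℝ) (w : X → ℝ), 0 ≤ C ∧ Measurable w ∧ (∀ x, 0 ≤ w x) ∧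
      ∫⁻ x, ENNReal.ofReal (w x) ∂μ ≤ ENNReal.ofReal η ∧
      ∀ x y, σ x y ≤ η + C * (∑ i ∈ Finset.range N, |g i x - g i y|) + w x + w y := by
  obtain ⟨M, hM, hMt⟩ := aux_tail μ u hu hfin (η / 4) (by positivity)
  have hA : MeasurableSet (S ∩ {x | u x ≤ M}) := hS.inter (measurableSet_le hu measurable_const)
  obtain ⟨L, hLA, hL, hLm⟩ := hA.exists_isCompact_sdiff_lt (μ := μ) (measure_ne_top _ _)
    (ε := ENNReal.ofReal (η / (4 * M))) (by simp; positivity)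
  -- compactness
  let U : ℕ → Set (X × X) := fun N =>
    {p | 1 / ((N : ℝ) + 1) < ∑ i ∈ Finset.range N, |g i p.1 - g i p.2|} ∪
      {p | ∃ j, F j p.1 + F j p.2 < η}
  have hUo : ∀ N, IsOpen (U N) := by
    intro N
    refine IsOpen.union (isOpen_lt (by fun_prop) (by fun_prop)) ?_
    have : {p : X × X | ∃ j, F j p.1 + F j p.2 < η} = ⋃ j, {p | F j p.1 + F j p.2 < η} := by
      ext; simp
    rw [this]
    exact isOpen_iUnion fun j => isOpen_lt (by fun_prop) (by fun_prop)
  have hUmono : Monotone U := by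
    intro a b hab
    refine union_subset_union_left _ ?_
    intro p hp
    simp only [mem_ofPred_eq] at hp ⊢
    calc 1 / ((b : ℝ) + 1) ≤ 1 / ((a : ℝ) + 1) := by gcongr
      _ < _ := hp
      _ ≤ _ := Finset.sum_le_sum_of_subset_of_nonneg (Finset.range_mono hab)
          (fun _ _ _ => abs_nonneg _)
  have hcov : L ×ˢ L ⊆ ⋃ N, U N := by
    rintro ⟨x, y⟩ ⟨hx, hy⟩
    have hxS := (hLA hx).1
    have hyS := (hLA hy).1
    by_cases hxy : ∀ i, g i x = g i y
    · have := hinj x hxS y hyS hxy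
      subst this
      obtain ⟨j, hj⟩ := hdense x hxS (η / 2) (by positivity)
      refine mem_iUnion.2 ⟨0, Or.inr ⟨j, ?_⟩⟩
      show F j x + F j x < η
      linarith
    · push Not at hxy
      obtain ⟨i, hi⟩ := hxy
      have hpos : 0 < |g i x - g i y| := abs_pos.2 (sub_ne_zero.2 hi)
      obtain ⟨n, hn⟩ := exists_nat_one_div_lt hpos
      refine mem_iUnion.2 ⟨max n (i + 1), Or.inl ?_⟩
      simp only [mem_ofPred_eq]
      calc 1 / (((max n (i + 1) : ℕ) : ℝ) + 1) ≤ 1 / ((n : ℝ) + 1) := by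
            gcongr; exact le_max_left _ _
        _ < _ := hn
        _ ≤ _ := Finset.single_le_sum (f := fun i => |g i x - g i y|)
            (fun _ _ => abs_nonneg _) (Finset.mem_range.2 (by omega))
  obtain ⟨N, hN⟩ := (hL.prod hL).elim_directed_cover U hUo hcov hUmono.directed_le
  have hLmeas : MeasurableSet L := hL.isClosed.measurableSet
  refine ⟨N, 2 * M * (N + 1), Lᶜ.indicator (fun x => u x + M), by positivity,
    (hu.add_const M).indicator hLmeas.compl, ?_, ?_, ?_⟩
  · exact fun x => indicator_nonneg (fun x _ => add_nonneg (hu0 x) hM.le) x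
  · have hle : ∀ᵐ x ∂μ, ENNReal.ofReal (Lᶜ.indicator (fun x => u x + M) x) ≤
        {x | M < u x}.indicator (fun x => 2 * ENNReal.ofReal (u x)) x +
        ((S ∩ {x | u x ≤ M}) \ L).indicator (fun _ => ENNReal.ofReal (2 * M)) x := by
      have hSae : ∀ᵐ x ∂μ, x ∈ S := by rw [ae_iff]; exact hSc
      filter_upwards [hSae] with x hxS
      by_cases hxL : x ∈ L
      · simp [hxL]
      · by_cases hxM : M < u x
        · have : ENNReal.ofReal (u x + M) ≤ 2 * ENNReal.ofReal (u x) := by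
            rw [two_mul, ← ENNReal.ofReal_add (hu0 x) (hu0 x)]
            exact ENNReal.ofReal_le_ofReal (by linarith)
          simp [hxL, hxM, not_le.2 hxM, this]
        · have : ENNReal.ofReal (u x + M) ≤ ENNReal.ofReal (2 * M) :=
            ENNReal.ofReal_le_ofReal (by linarith)
          have h2 := not_lt.1 hxM
          simp only [indicator, mem_compl_iff, hxL, Set.mem_sdiff, mem_inter_iff, hxS, mem_ofPred_eq,
            hxM, h2, not_false_eq_true, if_true, if_false, and_self, zero_add]
          exact this
    have hm1 : MeasurableSet {x | M < u x} := measurableSet_lt measurable_const hu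
    refine (lintegral_mono_ae hle).trans ?_
    rw [lintegral_add_left ((hu.ennreal_ofReal.const_mul 2).indicator hm1),
      lintegral_indicator hm1, lintegral_const_mul _ hu.ennreal_ofReal,
      lintegral_indicator (hA.diff hLmeas), lintegral_const, Measure.restrict_apply_univ]
    calc _ ≤ 2 * ENNReal.ofReal (η / 4) + ENNReal.ofReal (2 * M) * ENNReal.ofReal (η / (4 * M)) := by
          gcongr
      _ = ENNReal.ofReal η := by
          rw [← ENNReal.ofReal_mul (by positivity), show (2 : ℝ≥0∞) = ENNReal.ofReal 2 by simp,
            ← ENNReal.ofReal_mul (by positivity), ← ENNReal.ofReal_add (by positivity) (by positivity)]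
          congr 1
          field_simp
          ring
  · intro x y
    have hsum : 0 ≤ 2 * M * ((N : ℝ) + 1) * ∑ i ∈ Finset.range N, |g i x - g i y| := by positivity
    have hx0 := hu0 x
    have hy0 := hu0 y
    have := hσu x y
    by_cases hx : x ∈ L
    · have hxM : u x ≤ M := (hLA hx).2
      by_cases hy : y ∈ L
      · have hyM : u y ≤ M := (hLA hy).2
        simp only [indicator, mem_compl_iff, hx, hy, not_true_eq_false, if_false, add_zero]
        rcases hN (mk_mem_prod hx hy) with h | ⟨j, hj⟩
        · have h : 1 / ((N : ℝ) + 1) < ∑ i ∈ Finset.range N, |g i x - g i y| := h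
          rw [div_lt_iff₀ (by positivity)] at h
          have : 2 * M * 1 ≤ 2 * M * ((∑ i ∈ Finset.range N, |g i x - g i y|) * ((N : ℝ) + 1)) := by
            gcongr
          nlinarith
        · have := hσF j x y
          have hj : F j x + F j y < η := hj
          linarith
      · simp only [indicator, mem_compl_iff, hx, hy, not_true_eq_false, if_false, add_zero,
          not_false_eq_true, if_true]
        linarith
    · by_cases hy : y ∈ L
      · have hyM : u y ≤ M := (hLA hy).2
        simp only [indicator, mem_compl_iff, hx, hy, not_true_eq_false, if_false, add_zero,
          not_false_eq_true, if_true]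
        linarith
      · simp only [indicator, mem_compl_iff, hx, hy, 
          not_false_eq_true, if_true]
        linarith

theorem aux_static {X : Type*} [MeasurableSpace X] [StandardBorelSpace X]
    (μ : Measure X) [IsProbabilityMeasure μ]
    (g F : ℕ → X → ℝ) (hg : ∀ i, Measurable (g i)) (hF : ∀ i, Measurable (F i))
    (u : X → ℝ) (hu : Measurable u) (hu0 : ∀ x, 0 ≤ u x)
    (hfin : ∫⁻ x, ENNReal.ofReal (u x) ∂μ ≠ ⊤)
    (S : Set X) (hS : MeasurableSet S) (hSc : μ Sᶜ = 0)
    (hinj : ∀ x ∈ S, ∀ y ∈ S, (∀ i, g i x = g i y) → x = y)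
    (hdense : ∀ x ∈ S, ∀ ε : ℝ, 0 < ε → ∃ j, F j x < ε)
    (σ : X → X → ℝ) (hσF : ∀ j x y, σ x y ≤ F j x + F j y) (hσu : ∀ x y, σ x y ≤ u x + u y)
    (η : ℝ) (hη : 0 < η) :
    ∃ (N : ℕ) (C : ℝ) (w : X → ℝ), 0 ≤ C ∧ Measurable w ∧ (∀ x, 0 ≤ w x) ∧
      ∫⁻ x, ENNReal.ofReal (w x) ∂μ ≤ ENNReal.ofReal η ∧
      ∀ x y, σ x y ≤ η + C * (∑ i ∈ Finset.range N, |g i x - g i y|) + w x + w y := by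
  obtain ⟨t, hb, hp⟩ := StandardBorelSpace.polish (α := X)
  let f : X → (ℕ → ℝ) × (ℕ → ℝ) := fun x => (fun i => g i x, fun i => F i x)
  have hf : Measurable f :=
    (measurable_pi_lambda _ hg).prodMk (measurable_pi_lambda _ hF)
  obtain ⟨t', ht', hc, hp'⟩ := hf.exists_continuous
  have hb' : @BorelSpace X t' _ :=
    ⟨hb.measurable_eq.trans (borel_eq_borel_of_le hp' hp ht').symm⟩
  let _ := t'
  have hc1 : ∀ i, @Continuous X ℝ t' _ (g i) := fun i =>
    (continuous_apply i).comp (continuous_fst.comp hc)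
  have hc2 : ∀ i, @Continuous X ℝ t' _ (F i) := fun i =>
    (continuous_apply i).comp (continuous_snd.comp hc)
  exact @aux_static_top X _ t' hp' hb' μ _ g F hc1 hc2 u hu hu0 hfin S hS hSc hinj hdense σ hσF hσu
    η hη

theorem aux_mp {X : Type*} [MeasurableSpace X] (μ : Measure X) (T : Equiv.Perm X)
    (hT : Measurable (⇑T)) (hTs : Measurable (⇑T.symm)) (h : MeasurePreserving (⇑T) μ μ) (k : ℤ) :
    MeasurePreserving (⇑(T ^ k)) μ μ := by
  have hs : MeasurePreserving (⇑T.symm) μ μ :=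
    MeasurePreserving.symm (⟨T, hT, hTs⟩ : X ≃ᵐ X) h
  have hnat : ∀ S : Equiv.Perm X, MeasurePreserving (⇑S) μ μ → ∀ n : ℕ,
      MeasurePreserving (⇑(S ^ n)) μ μ := by
    intro S hS n
    have := hS.iterate n
    rwa [← Equiv.Perm.coe_pow] at this
  rcases Int.eq_nat_or_neg k with ⟨n, rfl | rfl⟩
  · rw [zpow_natCast]; exact hnat T h n
  · rw [zpow_neg, zpow_natCast, ← inv_pow]; exact hnat _ hs n

theorem aux_integral_comp {X : Type*} [MeasurableSpace X] {μ : Measure X} {f : X → X}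
    (hf : MeasurePreserving f μ μ) {v : X → ℝ} (hv : Measurable v) :
    ∫ x, v (f x) ∂μ = ∫ x, v x ∂μ := by
  have := integral_map (μ := μ) hf.measurable.aemeasurable (f := v) hv.aestronglyMeasurable
  rw [← this, hf.map_eq]

theorem aux_shift (a : ℤ → ℝ) (ha : ∀ j, 0 ≤ a j) (n K : ℕ) (k : ℤ) (hk : |k| ≤ K) :
    ∑ j ∈ Finset.range n, a (k + j) ≤ ∑ j ∈ Finset.range n, a j +
      ∑ j ∈ Finset.Ico (-K : ℤ) 0 ∪ Finset.Ico (n : ℤ) (n + K), a j := by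
  have hk' := abs_le.1 hk
  have h1 : ∑ j ∈ Finset.range n, a (k + j) =
      ∑ j ∈ (Finset.range n).image (fun j : ℕ => k + (j : ℤ)), a j := by
    rw [Finset.sum_image]
    intro x _ y _ hxy
    simpa using hxy
  have h2 : ∑ j ∈ Finset.range n, a j =
      ∑ j ∈ (Finset.range n).image (fun j : ℕ => (j : ℤ)), a j := by
    rw [Finset.sum_image]
    intro x _ y _ hxy
    simpa using hxy
  rw [h1, h2, ← Finset.sum_union]
  · refine Finset.sum_le_sum_of_subset_of_nonneg ?_ (fun _ _ _ => ha _)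
    intro j hj
    simp only [Finset.mem_image, Finset.mem_range, Finset.mem_union, Finset.mem_Ico] at hj ⊢
    obtain ⟨i, hi, rfl⟩ := hj
    by_cases h3 : k + i < 0
    · right; left; omega
    · by_cases h4 : k + i < n
      · left; exact ⟨(k + i).toNat, by omega, by omega⟩
      · right; right; omega
  · rw [Finset.disjoint_left]
    intro j hj
    simp only [Finset.mem_image, Finset.mem_range, Finset.mem_union, Finset.mem_Ico] at hj ⊢
    obtain ⟨i, hi, rfl⟩ := hj
    omega

theorem aux_avg {X : Type*} [MeasurableSpace X] (μ : Measure X) [IsProbabilityMeasure μ]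
    (T : Equiv.Perm X) (hmp : ∀ k : ℤ, MeasurePreserving (⇑(T ^ k)) μ μ)
    (ρ σ : X → X → ℝ) (hρ0 : ∀ x y, 0 ≤ ρ x y)
    (v w : X → ℝ) (hv : Measurable v) (hw : Measurable w) (hv0 : ∀ x, 0 ≤ v x)
    (hw0 : ∀ x, 0 ≤ w x) (hvi : Integrable v μ) (hwi : Integrable w μ)
    (hρv : ∀ x y, ρ x y ≤ v x + v y) (η : ℝ) (hη : 0 < η) (hwη : ∫ x, w x ∂μ ≤ η)
    (N : ℕ) (k : ℕ → ℤ) (C : ℝ) (hC : 0 ≤ C)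
    (hst : ∀ x y, σ x y ≤ η + C * (∑ i ∈ Finset.range N, ρ ((T ^ k i) x) ((T ^ k i) y)) + w x + w y) :
    ∃ n₀ : ℕ, ∀ n ≥ n₀, ∃ W : X → ℝ, Measurable W ∧ (∀ x, 0 ≤ W x) ∧ Integrable W μ ∧
      ∫ x, W x ∂μ ≤ 2 * η ∧
      ∀ x y, avgSemimetric T σ n x y ≤ η + C * N * avgSemimetric T ρ n x y + W x + W y := by
  obtain ⟨K, hK⟩ : ∃ K : ℕ, ∀ i < N, |k i| ≤ K := by
    refine ⟨∑ i ∈ Finset.range N, (k i).natAbs, fun i hi => ?_⟩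
    have := Finset.single_le_sum (f := fun i => (k i).natAbs) (fun _ _ => Nat.zero_le _)
      (Finset.mem_range.2 hi)
    rw [Int.abs_eq_natAbs]
    exact_mod_cast this
  obtain ⟨n₁, hn₁⟩ := exists_nat_ge (C * N * (2 * K) * (∫ x, v x ∂μ) / η)
  refine ⟨n₁ + 1, fun n hn => ?_⟩
  have hnpos : 0 < (n : ℝ) := by exact_mod_cast (by omega : 0 < n)
  let J : Finset ℤ := Finset.Ico (-K : ℤ) 0 ∪ Finset.Ico (n : ℤ) (n + K)
  have hJ : (J.card : ℝ) ≤ 2 * K := by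
    have := Finset.card_union_le (Finset.Ico (-K : ℤ) 0) (Finset.Ico (n : ℤ) (n + K))
    simp only [Int.card_Ico] at this
    have h2 : J.card ≤ 2 * K := by
      refine this.trans ?_
      omega
    exact_mod_cast h2
  have hiv : ∀ j : ℤ, Integrable (fun x => v ((T ^ j) x)) μ := fun j =>
    (hmp j).integrable_comp_of_integrable hvi
  have hiw : ∀ j : ℕ, Integrable (fun x => w ((T ^ j) x)) μ := fun j => by
    have := (hmp j).integrable_comp_of_integrable hwi
    rwa [zpow_natCast] at this
  refine ⟨fun x => (∑ j ∈ Finset.range n, w ((T ^ j) x)) / n +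
      C * N / n * ∑ j ∈ J, v ((T ^ j) x), ?_, ?_, ?_, ?_, ?_⟩
  · refine Measurable.add (Measurable.div_const (Finset.measurable_sum _ fun j _ => ?_) _)
      (Measurable.const_mul (Finset.measurable_sum _ fun j _ => ?_) _)
    · have := (hmp j).measurable
      rw [zpow_natCast] at this
      exact hw.comp this
    · exact hv.comp (hmp j).measurable
  · intro x
    have h1 : 0 ≤ ∑ j ∈ Finset.range n, w ((T ^ j) x) := Finset.sum_nonneg fun _ _ => hw0 _
    have h2 : 0 ≤ ∑ j ∈ J, v ((T ^ j) x) := Finset.sum_nonneg fun _ _ => hv0 _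
    positivity
  · exact ((integrable_finsetSum _ fun j _ => hiw j).div_const _).add
      ((integrable_finsetSum _ fun j _ => hiv j).const_mul _)
  · rw [integral_add ((integrable_finsetSum _ fun j _ => hiw j).div_const _)
      ((integrable_finsetSum _ fun j _ => hiv j).const_mul _), integral_div, integral_const_mul,
      integral_finsetSum _ (fun j _ => hiw j), integral_finsetSum _ (fun j _ => hiv j)]
    have e1 : ∀ j : ℕ, ∫ x, w ((T ^ j) x) ∂μ = ∫ x, w x ∂μ := fun j => by
      have := aux_integral_comp (hmp j) hw
      rwa [zpow_natCast] at this
    have e2 : ∀ j : ℤ, ∫ x, v ((T ^ j) x) ∂μ = ∫ x, v x ∂μ := fun j =>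
      aux_integral_comp (hmp j) hv
    simp only [e1, e2, Finset.sum_const, Finset.card_range, nsmul_eq_mul]
    have hI : 0 ≤ ∫ x, v x ∂μ := integral_nonneg hv0
    rw [mul_div_cancel_left₀ _ hnpos.ne']
    have h3 : C * N / n * (J.card * ∫ x, v x ∂μ) ≤ η := by
      rw [div_le_iff₀ hη] at hn₁
      have hn' : (n₁ : ℝ) ≤ n := by exact_mod_cast (by omega : n₁ ≤ n)
      calc C * N / n * (J.card * ∫ x, v x ∂μ) ≤ C * N / n * (2 * K * ∫ x, v x ∂μ) := by gcongr
        _ = (C * N * (2 * K) * ∫ x, v x ∂μ) / n := by ring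
        _ ≤ (n * η) / n := by
            have h5 : C * N * (2 * K) * (∫ x, v x ∂μ) ≤ n * η := hn₁.trans (by gcongr)
            exact div_le_div_of_nonneg_right h5 hnpos.le
        _ = η := by field_simp
    linarith
  · intro x y
    have key : ∀ i < N, ∑ j ∈ Finset.range n, ρ ((T ^ k i) ((T ^ j) x)) ((T ^ k i) ((T ^ j) y)) ≤
        ∑ j ∈ Finset.range n, ρ ((T ^ j) x) ((T ^ j) y) +
          (∑ j ∈ J, v ((T ^ j) x) + ∑ j ∈ J, v ((T ^ j) y)) := by
      intro i hi
      have h := aux_shift (fun j : ℤ => ρ ((T ^ j) x) ((T ^ j) y)) (fun _ => hρ0 _ _) n K (k i) (hK i hi)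
      simp only [zpow_add, zpow_natCast, Equiv.Perm.mul_apply] at h
      refine h.trans ?_
      gcongr
      rw [← Finset.sum_add_distrib]
      exact Finset.sum_le_sum fun j _ => hρv _ _
    have hs : ∑ j ∈ Finset.range n, σ ((T ^ j) x) ((T ^ j) y) ≤
        n * η + C * (N * (∑ j ∈ Finset.range n, ρ ((T ^ j) x) ((T ^ j) y) +
          (∑ j ∈ J, v ((T ^ j) x) + ∑ j ∈ J, v ((T ^ j) y)))) +
        ∑ j ∈ Finset.range n, w ((T ^ j) x) + ∑ j ∈ Finset.range n, w ((T ^ j) y) := by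
      refine (Finset.sum_le_sum fun j _ => hst ((T ^ j) x) ((T ^ j) y)).trans ?_
      simp only [Finset.sum_add_distrib, ← Finset.mul_sum, Finset.sum_const, Finset.card_range,
        nsmul_eq_mul]
      rw [Finset.sum_comm]
      gcongr
      refine (Finset.sum_le_sum fun i hi => key i (Finset.mem_range.1 hi)).trans ?_
      rw [Finset.sum_const, Finset.card_range, nsmul_eq_mul]
    unfold avgSemimetric
    rw [div_le_iff₀ hnpos]
    refine hs.trans (le_of_eq ?_)
    field_simp
    ring

theorem aux_partition {X : Type*} [MeasurableSpace X] (μ : Measure X) (ρ : X → X → ℝ) (ε : ℝ)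
    (k : ℕ) (B : Fin (k + 1) → Set X) (hB : ∀ j, MeasurableSet (B j)) (hB0 : B 0 = ∅)
    (hμ : μ (⋃ j, B j)ᶜ < ENNReal.ofReal ε)
    (hd : ∀ j, ∀ x ∈ B j, ∀ y ∈ B j, ρ x y < ε) : IsEntropyPartition μ ρ ε k := by
  classical
  have hdis : ∀ i j, i < j → Disjoint (B i \ ⋃ l, ⋃ (_ : l < i), B l) (B j \ ⋃ l, ⋃ (_ : l < j), B l) := by
    intro i j hij
    rw [Set.disjoint_left]
    rintro x ⟨hx, -⟩ ⟨-, hx'⟩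
    exact hx' (mem_iUnion₂.2 ⟨i, hij, hx⟩)
  refine ⟨fun j => if j = 0 then (⋃ j, B j)ᶜ else B j \ ⋃ l, ⋃ (_ : l < j), B l, ?_, ?_, ?_, ?_, ?_⟩
  · intro j
    dsimp only
    split_ifs
    · exact (MeasurableSet.iUnion hB).compl
    · exact (hB j).diff (MeasurableSet.iUnion fun l => MeasurableSet.iUnion fun _ => hB l)
  · have h0 : ∀ j, Disjoint (⋃ j, B j)ᶜ (B j \ ⋃ l, ⋃ (_ : l < j), B l) := by
      intro j
      rw [Set.disjoint_left]
      rintro x hx ⟨hx', -⟩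
      exact hx (mem_iUnion.2 ⟨j, hx'⟩)
    intro i j hij
    dsimp only
    split_ifs with h1 h2 h2
    · exact absurd (h1.trans h2.symm) hij
    · exact h0 j
    · exact (h0 i).symm
    · rcases lt_or_gt_of_ne hij with h | h
      · exact hdis i j h
      · exact (hdis j i h).symm
  · rw [eq_univ_iff_forall]
    intro x
    by_cases hx : ∃ j, x ∈ B j
    · obtain ⟨j, hj, hmin⟩ := WellFounded.has_min (wellFounded_lt (α := Fin (k + 1))) {j | x ∈ B j} hx
      have hj : x ∈ B j := hj
      have hj0 : j ≠ 0 := by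
        rintro rfl
        rw [hB0] at hj
        exact hj
      refine mem_iUnion.2 ⟨j, ?_⟩
      rw [if_neg hj0]
      refine ⟨hj, fun h => ?_⟩
      obtain ⟨l, hl, hxl⟩ := mem_iUnion₂.1 h
      exact hmin l hxl hl
    · refine mem_iUnion.2 ⟨0, ?_⟩
      rw [if_pos rfl]
      intro h
      exact hx (mem_iUnion.1 h)
  · simpa using hμ
  · intro j hj x hx y hy
    dsimp only at hx hy
    rw [if_neg hj] at hx hy
    exact hd j x hx.1 y hy.1

theorem aux_entropy_le {X Y : Type*} [MeasurableSpace X] [MeasurableSpace Y] (μ : Measure X)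
    (ν : Measure Y) (ρ : X → X → ℝ) (τ : Y → Y → ℝ) (δ ε : ℝ)
    (h : ∀ k, IsEntropyPartition μ ρ δ k → IsEntropyPartition ν τ ε k) :
    epsEntropy ν τ ε ≤ epsEntropy μ ρ δ := by
  classical
  unfold epsEntropy
  split_ifs with h1 h2 h2
  · apply ENNReal.ofReal_le_ofReal
    have hle : Nat.find h1 ≤ Nat.find h2 := Nat.find_min' h1 (h _ (Nat.find_spec h2))
    rcases Nat.eq_zero_or_pos (Nat.find h1) with h0 | h0
    · rw [h0]
      simp only [Nat.cast_zero, Real.logb_zero]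
      rcases Nat.eq_zero_or_pos (Nat.find h2) with h3 | h3
      · rw [h3]; simp
      · exact Real.logb_nonneg (by norm_num) (by exact_mod_cast h3)
    · exact Real.logb_le_logb_of_le (by norm_num) (by exact_mod_cast h0) (by exact_mod_cast hle)
  · exact le_top
  · exact absurd ⟨_, h _ h2.choose_spec⟩ h1
  · exact le_rfl

theorem aux_base {X : Type*} [MeasurableSpace X] (μ : Measure X) [IsProbabilityMeasure μ]
    (ρ : X → X → ℝ) (hρ : IsSemimetric ρ) (hm : Measurable (fun p : X × X => ρ p.1 p.2))
    (hi : Integrable (fun p : X × X => ρ p.1 p.2) (μ.prod μ)) :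
    ∃ z, Measurable (fun x => ρ x z) ∧ Integrable (fun x => ρ x z) μ := by
  obtain ⟨z, hz⟩ := hi.prod_right_ae.exists
  refine ⟨z, hm.comp (measurable_id.prodMk measurable_const), ?_⟩
  refine hz.congr (ae_of_all _ fun x => ?_)
  exact hρ.symm _ _

theorem aux_dense {X : Type*} [MeasurableSpace X] (μ : Measure X) [IsProbabilityMeasure μ]
    (ρ : X → X → ℝ) (h : IsAdmissible μ ρ) :
    ∃ d : ℕ → X, ∀ᵐ x ∂μ, ∀ ε : ℝ, 0 < ε → ∃ j, ρ x (d j) < ε := by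
  obtain ⟨s, -, hs0, D, hDc, -, hD⟩ := h
  have hs : ∀ᵐ x ∂μ, x ∈ s := by rw [ae_iff]; exact hs0
  obtain ⟨x, hx⟩ := hs.exists
  obtain ⟨y, hy, -⟩ := hD x hx 1 one_pos
  obtain ⟨d, rfl⟩ := hDc.exists_eq_range ⟨y, hy⟩
  refine ⟨d, ?_⟩
  filter_upwards [hs] with x hx ε hε
  obtain ⟨_, ⟨j, rfl⟩, hj⟩ := hD x hx ε hε
  exact ⟨j, hj⟩

theorem aux_main {X₁ : Type*} [MeasurableSpace X₁] [StandardBorelSpace X₁]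
    {X₂ : Type*} [MeasurableSpace X₂]
    (μ₁ : Measure X₁) [IsProbabilityMeasure μ₁]
    (μ₂ : Measure X₂) [IsProbabilityMeasure μ₂]
    (T₁ : Equiv.Perm X₁) (hmp : ∀ k : ℤ, MeasurePreserving (⇑(T₁ ^ k)) μ₁ μ₁)
    (T₂ : Equiv.Perm X₂) (hT₂ : Measurable (⇑T₂))
    (φ : X₁ → X₂) (hφ : MeasurePreserving φ μ₁ μ₂)
    (hconj : ∀ᵐ x ∂μ₁, φ (T₁ x) = T₂ (φ x))
    (ρ₁ : X₁ → X₁ → ℝ) (hρ₁ : IsSemimetric ρ₁) (hm₁ : Measurable (fun p : X₁ × X₁ => ρ₁ p.1 p.2))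
    (hi₁ : Integrable (fun p : X₁ × X₁ => ρ₁ p.1 p.2) (μ₁.prod μ₁))
    (ha₁ : IsAdmissible μ₁ ρ₁) (hg₁ : IsGenerating μ₁ T₁ ρ₁)
    (ρ₂ : X₂ → X₂ → ℝ) (hρ₂ : IsSemimetric ρ₂) (hm₂ : Measurable (fun p : X₂ × X₂ => ρ₂ p.1 p.2))
    (hi₂ : Integrable (fun p : X₂ × X₂ => ρ₂ p.1 p.2) (μ₂.prod μ₂))
    (ha₂ : IsAdmissible μ₂ ρ₂) (ε : ℝ) (hε : 0 < ε) :
    ∃ δ : ℝ, 0 < δ ∧ ∃ n₀ : ℕ, ∀ n ≥ n₀,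
      epsEntropy μ₂ (avgSemimetric T₂ ρ₂ n) ε ≤ epsEntropy μ₁ (avgSemimetric T₁ ρ₁ n) δ := by
  classical
  obtain ⟨z₁, hz₁m, hz₁i⟩ := aux_base μ₁ ρ₁ hρ₁ hm₁ hi₁
  obtain ⟨z₂, hz₂m, hz₂i⟩ := aux_base μ₂ ρ₂ hρ₂ hm₂ hi₂
  obtain ⟨d₁, hd₁⟩ := aux_dense μ₁ ρ₁ ha₁
  obtain ⟨d₂, hd₂⟩ := aux_dense μ₂ ρ₂ ha₂
  obtain ⟨s, -, hs0, hsep⟩ := hg₁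
  have hs : ∀ᵐ x ∂μ₁, x ∈ s := by rw [ae_iff]; exact hs0
  have hd₁' : ∀ᵐ x ∂μ₁, ∀ k : ℤ, ∀ ε : ℝ, 0 < ε → ∃ j, ρ₁ ((T₁ ^ k) x) (d₁ j) < ε := by
    rw [ae_all_iff]
    exact fun k => (hmp k).quasiMeasurePreserving.ae hd₁
  have hd₂' : ∀ᵐ x ∂μ₁, ∀ ε : ℝ, 0 < ε → ∃ j, ρ₂ (φ x) (d₂ j) < ε :=
    hφ.quasiMeasurePreserving.ae hd₂
  have hall := hs.and (hd₁'.and hd₂')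
  rw [ae_iff] at hall
  obtain ⟨Z, hZsub, hZm, hZ0⟩ := exists_measurable_superset_of_null hall
  have hZ : ∀ x ∈ Zᶜ, x ∈ s ∧ (∀ k : ℤ, ∀ ε : ℝ, 0 < ε → ∃ j, ρ₁ ((T₁ ^ k) x) (d₁ j) < ε) ∧
      ∀ ε : ℝ, 0 < ε → ∃ j, ρ₂ (φ x) (d₂ j) < ε := by
    intro x hx
    by_contra hcon
    exact hx (hZsub hcon)
  let e : ℕ ≃ ℤ × ℕ := (Denumerable.eqv (ℤ × ℕ)).symm
  let g : ℕ → X₁ → ℝ := fun i x => ρ₁ ((T₁ ^ (e i).1) x) (d₁ (e i).2)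
  have hgm : ∀ i, Measurable (g i) := fun i =>
    hm₁.comp ((hmp (e i).1).measurable.prodMk measurable_const)
  have hFm : ∀ j, Measurable (fun x => ρ₂ (φ x) (d₂ j)) := fun j =>
    hm₂.comp (hφ.measurable.prodMk measurable_const)
  let t : ℝ := ε / 16
  have ht : 0 < t := by positivity
  let η : ℝ := min (ε / 16) (ε * t / 16)
  have hη : 0 < η := by positivity
  have hη1 : η ≤ ε / 16 := min_le_left _ _
  have hη2 : η ≤ ε * t / 16 := min_le_right _ _
  have hui : Integrable (fun x => ρ₂ (φ x) z₂) μ₁ := hφ.integrable_comp_of_integrable hz₂i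
  have htri : ∀ x y c, ρ₂ x y ≤ ρ₂ x c + ρ₂ y c := fun x y c => by
    rw [hρ₂.symm y c]; exact hρ₂.triangle x c y
  obtain ⟨N, C, w, hC, hwm, hw0, hwl, hst⟩ := aux_static μ₁ g (fun j x => ρ₂ (φ x) (d₂ j)) hgm hFm
    (fun x => ρ₂ (φ x) z₂) (hz₂m.comp hφ.measurable) (fun x => hρ₂.nonneg _ _)
    hui.lintegral_lt_top.ne Zᶜ hZm.compl (by simpa using hZ0)
    (by
      intro x hx y hy hxy
      by_contra hne
      obtain ⟨k, hk⟩ := hsep x (hZ x hx).1 y (hZ y hy).1 hne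
      obtain ⟨j, hj⟩ := (hZ x hx).2.1 k (ρ₁ ((T₁ ^ k) x) ((T₁ ^ k) y) / 2) (by positivity)
      have h1 := hxy (e.symm (k, j))
      simp only [g, Equiv.apply_symm_apply] at h1
      have h2 := hρ₁.triangle ((T₁ ^ k) x) (d₁ j) ((T₁ ^ k) y)
      rw [hρ₁.symm (d₁ j)] at h2
      linarith)
    (fun x hx => (hZ x hx).2.2) (fun x y => ρ₂ (φ x) (φ y)) (fun j x y => htri _ _ _)
    (fun x y => htri _ _ _) η hη
  have hwi : Integrable w μ₁ :=
    (lintegral_ofReal_ne_top_iff_integrable hwm.aestronglyMeasurable (ae_of_all _ hw0)).1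
      (ne_top_of_le_ne_top ENNReal.ofReal_ne_top hwl)
  have hwη : ∫ x, w x ∂μ₁ ≤ η := by
    rw [← ofReal_integral_eq_lintegral_ofReal hwi (ae_of_all _ hw0)] at hwl
    exact (ENNReal.ofReal_le_ofReal_iff hη.le).1 hwl
  have hgρ : ∀ i x y, |g i x - g i y| ≤ ρ₁ ((T₁ ^ (e i).1) x) ((T₁ ^ (e i).1) y) := by
    intro i x y
    have h1 := hρ₁.triangle ((T₁ ^ (e i).1) x) ((T₁ ^ (e i).1) y) (d₁ (e i).2)
    have h2 := hρ₁.triangle ((T₁ ^ (e i).1) y) ((T₁ ^ (e i).1) x) (d₁ (e i).2)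
    rw [hρ₁.symm ((T₁ ^ (e i).1) y) ((T₁ ^ (e i).1) x)] at h2
    rw [abs_le]
    constructor <;> simp only [g] <;> linarith
  obtain ⟨n₀, hn₀⟩ := aux_avg μ₁ T₁ hmp ρ₁ (fun x y => ρ₂ (φ x) (φ y)) hρ₁.nonneg
    (fun x => ρ₁ x z₁) w hz₁m hwm (fun x => hρ₁.nonneg _ _) hw0 hz₁i hwi
    (fun x y => by rw [hρ₁.symm y z₁]; exact hρ₁.triangle x z₁ y) η hη hwη N (fun i => (e i).1) C hC
    (fun x y => (hst x y).trans (by gcongr; exact hgρ _ _ _))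
  let δ : ℝ := min (ε / 4) (ε / (8 * (C * N + 1)))
  have hCN : 0 ≤ C * N := by positivity
  have hδ : 0 < δ := by positivity
  have hδ1 : δ ≤ ε / 4 := min_le_left _ _
  have hδ2 : C * N * δ ≤ ε / 8 := by
    have h1 : δ ≤ ε / (8 * (C * N + 1)) := min_le_right _ _
    rw [le_div_iff₀ (by positivity)] at h1
    nlinarith
  -- almost everywhere conjugacy for all powers
  have hconj' : ∀ᵐ x ∂μ₁, ∀ j : ℕ, φ ((T₁ ^ j) x) = (T₂ ^ j) (φ x) := by
    have h1 : ∀ᵐ x ∂μ₁, ∀ j : ℕ, φ (T₁ ((T₁ ^ j) x)) = T₂ (φ ((T₁ ^ j) x)) := by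
      rw [ae_all_iff]
      intro j
      have := (hmp j).quasiMeasurePreserving.ae hconj
      simpa only [zpow_natCast] using this
    filter_upwards [h1] with x hx j
    induction j with
    | zero => simp
    | succ j ih =>
      rw [pow_succ', pow_succ', Equiv.Perm.mul_apply, Equiv.Perm.mul_apply, hx, ih]
  refine ⟨δ, hδ, n₀, fun n hn => aux_entropy_le _ _ _ _ _ _ ?_⟩
  obtain ⟨W, hWm, hW0, hWi, hWη, hW⟩ := hn₀ n hn
  rintro k ⟨P, hPm, -, hPu, hP0, hPd⟩
  let Q : Set X₁ := {x | W x < t ∧ ∀ j : ℕ, φ ((T₁ ^ j) x) = (T₂ ^ j) (φ x)}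
  have hQc : μ₁ Qᶜ ≤ ENNReal.ofReal (ε / 4) := by
    have h1 : μ₁ Qᶜ ≤ μ₁ {x | t ≤ W x} := by
      apply measure_mono_ae
      filter_upwards [hconj'] with x hx hxQ
      by_contra hcon
      exact hxQ ⟨not_le.1 hcon, hx⟩
    have h2 := mul_meas_ge_le_integral_of_nonneg (ae_of_all _ hW0) hWi t
    refine h1.trans ?_
    rw [← ENNReal.ofReal_toReal (measure_ne_top μ₁ {x | t ≤ W x})]
    apply ENNReal.ofReal_le_ofReal
    have h3 : t * (μ₁ {x | t ≤ W x}).toReal ≤ t * (ε / 4) := by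
      refine h2.trans (hWη.trans ?_)
      nlinarith
    exact le_of_mul_le_mul_left h3 ht
  have hPQ : ∀ j, j ≠ 0 → ∀ x ∈ P j ∩ Q, ∀ y ∈ P j ∩ Q,
      avgSemimetric T₂ ρ₂ n (φ x) (φ y) < ε / 2 := by
    intro j hj x hx y hy
    have h1 := hW x y
    have h2 := hPd j hj x hx.1 y hy.1
    have h3 : avgSemimetric T₁ (fun x y => ρ₂ (φ x) (φ y)) n x y =
        avgSemimetric T₂ ρ₂ n (φ x) (φ y) := by
      unfold avgSemimetric
      congr 1
      refine Finset.sum_congr rfl fun i _ => ?_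
      simp only [hx.2.2, hy.2.2]
    rw [h3] at h1
    have h4 : C * N * avgSemimetric T₁ ρ₁ n x y ≤ C * N * δ := by gcongr
    have h5 : W x < t := hx.2.1
    have h6 : W y < t := hy.2.1
    have h7 : t = ε / 16 := rfl
    linarith
  have hcen : ∀ j : Fin (k + 1), ∃ B : Set X₂, MeasurableSet B ∧ (j = 0 → B = ∅) ∧
      (∀ x ∈ B, ∀ y ∈ B, avgSemimetric T₂ ρ₂ n x y < ε) ∧ (j ≠ 0 → P j ∩ Q ⊆ φ ⁻¹' B) := by
    intro j
    by_cases hj : j ≠ 0 ∧ (P j ∩ Q).Nonempty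
    · obtain ⟨hj0, c, hc⟩ := hj
      refine ⟨{y | avgSemimetric T₂ ρ₂ n y (φ c) < ε / 2}, ?_, fun h => absurd h hj0, ?_, ?_⟩
      · refine measurableSet_lt ?_ measurable_const
        unfold avgSemimetric
        refine Measurable.div_const (Finset.measurable_sum _ fun i _ => ?_) _
        have : Measurable (⇑(T₂ ^ i)) := by
          rw [Equiv.Perm.coe_pow]; exact hT₂.iterate i
        exact hm₂.comp (this.prodMk measurable_const)
      · intro x hx y hy
        simp only [mem_ofPred_eq] at hx hy
        have : avgSemimetric T₂ ρ₂ n x y ≤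
            avgSemimetric T₂ ρ₂ n x (φ c) + avgSemimetric T₂ ρ₂ n y (φ c) := by
          unfold avgSemimetric
          rw [← add_div, ← Finset.sum_add_distrib]
          gcongr
          exact htri _ _ _
        linarith
      · intro _ x hx
        exact hPQ j hj0 x hx c hc
    · refine ⟨∅, MeasurableSet.empty, fun _ => rfl, by simp, ?_⟩
      intro hj0
      have : P j ∩ Q = ∅ := by
        rw [← not_nonempty_iff_eq_empty]
        exact fun h => hj ⟨hj0, h⟩
      rw [this]
      exact empty_subset _
  choose B hBm hB0 hBd hBP using hcen
  refine aux_partition μ₂ _ ε k B hBm (hB0 0 rfl) ?_ hBd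
  rw [← hφ.measure_preimage (MeasurableSet.iUnion hBm).compl.nullMeasurableSet]
  have hsub : φ ⁻¹' (⋃ j, B j)ᶜ ⊆ P 0 ∪ Qᶜ := by
    intro x hx
    by_contra hcon
    simp only [mem_union, not_or, mem_compl_iff, not_not] at hcon
    have hxu : x ∈ ⋃ j, P j := hPu ▸ mem_univ x
    obtain ⟨j, hj⟩ := mem_iUnion.1 hxu
    have hj0 : j ≠ 0 := by rintro rfl; exact hcon.1 hj
    exact hx (mem_iUnion.2 ⟨j, hBP j hj0 ⟨hj, hcon.2⟩⟩)
  calc _ ≤ μ₁ (P 0 ∪ Qᶜ) := measure_mono hsub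
    _ ≤ μ₁ (P 0) + μ₁ Qᶜ := measure_union_le _ _
    _ ≤ ENNReal.ofReal δ + ENNReal.ofReal (ε / 4) := add_le_add hP0.le hQc
    _ = ENNReal.ofReal (δ + ε / 4) := (ENNReal.ofReal_add hδ.le (by positivity)).symm
    _ < ENNReal.ofReal ε := (ENNReal.ofReal_lt_ofReal_iff hε).2 (by linarith)

/-- If `(X₂,μ₂,T₂)` is a factor of `(X₁,μ₁,T₁)` and `h¹`, `h²` are scaling entropy
sequences of the respective systems, then `h²_n = O(h¹_n)` as `n → ∞`. -/
theorem scalingEntropySeq_isBigO_of_factor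
    {X₁ : Type*} [MeasurableSpace X₁] [StandardBorelSpace X₁]
    {X₂ : Type*} [MeasurableSpace X₂] [StandardBorelSpace X₂]
    (μ₁ : Measure X₁) [IsProbabilityMeasure μ₁]
    (μ₂ : Measure X₂) [IsProbabilityMeasure μ₂]
    (T₁ : Equiv.Perm X₁) (hT₁ : Measurable (⇑T₁)) (hT₁symm : Measurable (⇑T₁.symm))
    (hT₁erg : Ergodic (⇑T₁) μ₁)
    (T₂ : Equiv.Perm X₂) (hT₂ : Measurable (⇑T₂)) (hT₂symm : Measurable (⇑T₂.symm))
    (hT₂erg : Ergodic (⇑T₂) μ₂)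
    (φ : X₁ → X₂) (hφ : MeasurePreserving φ μ₁ μ₂)
    (hconj : ∀ᵐ x ∂μ₁, φ (T₁ x) = T₂ (φ x))
    (h₁ h₂ : ℕ → ℝ)
    (hh₁ : IsScalingEntropySeq μ₁ T₁ h₁) (hh₂ : IsScalingEntropySeq μ₂ T₂ h₂) :
    Asymptotics.IsBigO Filter.atTop h₂ h₁ := by
  obtain ⟨ρ₁, hρ₁, hm₁, hi₁, ha₁, hg₁, hp₁, hup₁, -⟩ := hh₁
  obtain ⟨ρ₂, hρ₂, hm₂, hi₂, ha₂, -, hp₂, -, ε₀, hε₀, hlow₂⟩ := hh₂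
  obtain ⟨δ, hδ, n₀, hn₀⟩ := aux_main μ₁ μ₂ T₁
    (aux_mp μ₁ T₁ hT₁ hT₁symm hT₁erg.toMeasurePreserving) T₂ hT₂ φ hφ hconj ρ₁ hρ₁ hm₁ hi₁ ha₁ hg₁
    ρ₂ hρ₂ hm₂ hi₂ ha₂ (ε₀ / 2) (by positivity)
  obtain ⟨c, hc0, hc⟩ := exists_between (hlow₂ (ε₀ / 2) (by positivity) (by linarith))
  obtain ⟨C, hC, hCtop⟩ := exists_between (hup₁ δ hδ)
  have hctop : c ≠ ⊤ := (hc.trans_le le_top).ne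
  have e1 := eventually_lt_of_lt_liminf hc
  have e2 := eventually_lt_of_limsup_lt hC
  refine Asymptotics.IsBigO.of_bound (C.toReal / c.toReal) ?_
  filter_upwards [e1, e2, eventually_ge_atTop n₀, eventually_ge_atTop 1] with n h1 h2 h3 h4
  have q1 := hp₁ n h4
  have q2 := hp₂ n h4
  rw [ENNReal.lt_div_iff_mul_lt (Or.inl (by simpa using q2)) (Or.inl ENNReal.ofReal_ne_top)] at h1
  rw [ENNReal.div_lt_iff (Or.inl (by simpa using q1)) (Or.inl ENNReal.ofReal_ne_top)] at h2
  have h5 : c * ENNReal.ofReal (h₂ n) ≤ C * ENNReal.ofReal (h₁ n) :=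
    h1.le.trans ((hn₀ n h3).trans h2.le)
  have h6 := ENNReal.toReal_mono (ENNReal.mul_ne_top hCtop.ne ENNReal.ofReal_ne_top) h5
  rw [ENNReal.toReal_mul, ENNReal.toReal_mul, ENNReal.toReal_ofReal q1.le,
    ENNReal.toReal_ofReal q2.le] at h6
  have hcpos : 0 < c.toReal := ENNReal.toReal_pos hc0.ne' hctop
  rw [Real.norm_of_nonneg q1.le, Real.norm_of_nonneg q2.le, div_mul_eq_mul_div, le_div_iff₀ hcpos]
  linarith
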